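/- Let G(q) = ∏_{n≥1} 1/((1 − q^{5n-1})(1 − q^{5n-4})) and H(q) = ∏_{n≥1} 1/((1 − q^{5n-2})(1 − q^{5n-3})) be the Rogers–Ramanujan products, and φ(q) = ∏_{n≥1}(1 − q^n). Then, as formal power series in q: H(q)·G(−q) + H(−q)·G(q) = 2·φ(q⁴)² / φ(q²)². -/

import Mathlib

open PowerSeries

noncomputable instance : TopologicalSpace (PowerSeries ℚ) :=
  inferInstanceAs (TopologicalSpace ((Unit →₀ ℕ) → ℚ))

/-- `G(q^j) = ∏_{n ≥ 1} 1/((1 - q^{j(5n-1)})(1 - q^{j(5n-4)}))`, the first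
Rogers–Ramanujan product evaluated at `q^j`. -/
noncomputable def G (j : ℕ) : PowerSeries ℚ :=
  ∏' n : ℕ, ((1 - (X : ℚ⟦X⟧) ^ (j * (5 * n + 4))) * (1 - X ^ (j * (5 * n + 1))))⁻¹

/-- `H(q^j) = ∏_{n ≥ 1} 1/((1 - q^{j(5n-2)})(1 - q^{j(5n-3)}))`, the second
Rogers–Ramanujan product evaluated at `q^j`. -/
noncomputable def H (j : ℕ) : PowerSeries ℚ :=
  ∏' n : ℕ, ((1 - (X : ℚ⟦X⟧) ^ (j * (5 * n + 3))) * (1 - X ^ (j * (5 * n + 2))))⁻¹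

/-- `φ(q^j) = ∏_{n ≥ 1} (1 - q^{j n})`. -/
noncomputable def phi (j : ℕ) : PowerSeries ℚ :=
  ∏' n : ℕ, (1 - (X : ℚ⟦X⟧) ^ (j * (n + 1)))

/-- The substitution `q ↦ -q`, a ring endomorphism of `ℚ⟦q⟧`. -/
noncomputable def neg : PowerSeries ℚ →+* PowerSeries ℚ := rescale (-1)

open Filter Topology

/-! ### Convergence of power series -/

theorem continuous_coeff (d : ℕ) : Continuous (coeff (R := ℚ) d) :=
  WithPiTopology.continuous_coeff ℚ d

theorem tendsto_iff_coeff_tendsto {ι : Type*} (f : ι → ℚ⟦X⟧) (u : Filter ι) (g : ℚ⟦X⟧) :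
    Tendsto f u (𝓝 g) ↔ ∀ d : ℕ, Tendsto (fun i => coeff d (f i)) u (𝓝 (coeff d g)) :=
  WithPiTopology.tendsto_iff_coeff_tendsto ℚ f u g

instance : T2Space ℚ⟦X⟧ := WithPiTopology.instT2Space ℚ

instance : IsTopologicalRing ℚ⟦X⟧ := WithPiTopology.instIsTopologicalRing ℚ

theorem continuous_neg_hom : Continuous neg := by
  refine continuous_iff_continuousAt.mpr fun f => ?_
  refine (tendsto_iff_coeff_tendsto _ _ _).mpr fun d => ?_
  simp only [neg, coeff_rescale]
  exact ((continuous_coeff d).tendsto f).const_mul _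

theorem coeff_eq_zero_of_X_pow_dvd {f : ℚ⟦X⟧} {n d : ℕ} (h : X ^ n ∣ f) (hd : d < n) :
    coeff d f = 0 :=
  X_pow_dvd_iff.mp h d hd

theorem tendsto_of_eventually_X_pow_dvd_sub {f : ℕ → ℚ⟦X⟧} {g : ℚ⟦X⟧}
    (h : ∀ D, ∀ᶠ n in atTop, X ^ D ∣ f n - g) : Tendsto f atTop (𝓝 g) := by
  refine (tendsto_iff_coeff_tendsto _ _ _).mpr fun d => tendsto_nhds_of_eventually_eq ?_
  filter_upwards [h (d + 1)] with n hn
  have := coeff_eq_zero_of_X_pow_dvd hn d.lt_succ_self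
  rwa [map_sub, sub_eq_zero] at this

theorem summable_of_X_pow_dvd {ι : Type*} {f : ι → ℚ⟦X⟧} {E : ι → ℕ}
    (hE : ∀ N, {i | E i ≤ N}.Finite) (hf : ∀ i, X ^ E i ∣ f i) : Summable f := by
  refine (WithPiTopology.summable_iff_summable_coeff ℚ).mpr fun d => ?_
  refine summable_of_hasFiniteSupport ((hE d).subset fun i hi => ?_)
  by_contra hlt
  exact hi (coeff_eq_zero_of_X_pow_dvd (hf i) (not_le.mp hlt))

theorem coeff_tsum_of_X_pow_dvd {ι : Type*} {f : ι → ℚ⟦X⟧} {E : ι → ℕ}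
    (hE : ∀ N, {i | E i ≤ N}.Finite) (hf : ∀ i, X ^ E i ∣ f i) (d : ℕ) :
    coeff d (∑' i, f i) = ∑ i ∈ (hE d).toFinset, coeff d (f i) := by
  rw [(summable_of_X_pow_dvd hE hf).map_tsum (coeff (R := ℚ) d) (continuous_coeff d)]
  refine tsum_eq_sum fun i hi => coeff_eq_zero_of_X_pow_dvd (hf i) ?_
  simpa using hi

/-- Interchange of a limit with a sum in which only finitely many terms affect each coefficient. -/
theorem tendsto_tsum_of_X_pow_dvd {ι : Type*} {f : ℕ → ι → ℚ⟦X⟧} {g : ι → ℚ⟦X⟧} {E : ι → ℕ}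
    (hE : ∀ N, {i | E i ≤ N}.Finite) (hf : ∀ n i, X ^ E i ∣ f n i) (hg : ∀ i, X ^ E i ∣ g i)
    (h : ∀ i, Tendsto (fun n => f n i) atTop (𝓝 (g i))) :
    Tendsto (fun n => ∑' i, f n i) atTop (𝓝 (∑' i, g i)) := by
  refine (tendsto_iff_coeff_tendsto _ _ _).mpr fun d => ?_
  simp only [coeff_tsum_of_X_pow_dvd hE (hf _), coeff_tsum_of_X_pow_dvd hE hg]
  exact tendsto_finsetSum _ fun i _ => (tendsto_iff_coeff_tendsto _ _ _).mp (h i) d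

theorem multipliable_of_X_pow_dvd {f : ℕ → ℚ⟦X⟧} (h : ∀ n, X ^ n ∣ f n - 1) :
    Multipliable f := by
  have key : Multipliable (fun n => 1 + (f n - 1)) := by
    refine WithPiTopology.multipliable_one_add_of_tendsto_order_atTop_nhds_top ℚ ?_
    refine ENat.tendsto_nhds_top_iff_natCast_lt.mpr fun n => eventually_atTop.mpr ⟨n + 1, ?_⟩
    intro m hm
    refine lt_of_lt_of_le ?_ (nat_le_order _ _ (X_pow_dvd_iff.mp (h m)))
    exact_mod_cast hm
  simpa using key

theorem constantCoeff_tprod {f : ℕ → ℚ⟦X⟧} (h : ∀ n, X ^ n ∣ f n - 1)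
    (h1 : ∀ n, constantCoeff (f n) = 1) : constantCoeff (∏' n, f n) = 1 := by
  rw [(multipliable_of_X_pow_dvd h).map_tprod (constantCoeff (R := ℚ))
    (WithPiTopology.continuous_constantCoeff ℚ)]
  simp [h1]

/-- Multiplying out an infinite product in consecutive blocks of length `d`. -/
theorem tprod_eq_tprod_prod_range {f : ℕ → ℚ⟦X⟧} {d : ℕ} (hd : 0 < d) (hf : Multipliable f)
    (hg : Multipliable fun n => ∏ i ∈ Finset.range d, f (d * n + i)) :
    ∏' n, f n = ∏' n, ∏ i ∈ Finset.range d, f (d * n + i) := by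
  have hblock : ∀ N, ∏ n ∈ Finset.range N, ∏ i ∈ Finset.range d, f (d * n + i) =
      ∏ i ∈ Finset.range (d * N), f i := by
    intro N
    induction N with
    | zero => simp
    | succ N ih => rw [Finset.prod_range_succ, ih, Nat.mul_succ, Finset.prod_range_add]
  have h2 := hf.tendsto_prod_tprod_nat.comp (tendsto_id.const_mul_atTop' hd)
  refine tendsto_nhds_unique h2 ?_
  simpa only [Function.comp_def, id, hblock] using hg.tendsto_prod_tprod_nat

/-! ### Gaussian binomial coefficients -/

/-- The Gaussian binomial coefficient evaluated at `q`. -/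
def gaussBinom {R : Type*} [CommRing R] (q : R) : ℕ → ℕ → R
  | _, 0 => 1
  | 0, _ + 1 => 0
  | n + 1, k + 1 => gaussBinom q n k + q ^ (k + 1) * gaussBinom q n (k + 1)

/-- The `q`-Pochhammer product `(1 - q) ⋯ (1 - q ^ n)`. -/
def qPoch {R : Type*} [CommRing R] (q : R) (n : ℕ) : R :=
  ∏ i ∈ Finset.range n, (1 - q ^ (i + 1))

section GaussBinom

variable {R : Type*} [CommRing R] (q : R)

theorem gaussBinom_zero_right (n : ℕ) : gaussBinom q n 0 = 1 := by
  cases n <;> rfl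

theorem gaussBinom_eq_zero_of_lt : ∀ {n k : ℕ}, n < k → gaussBinom q n k = 0
  | _, 0, h => absurd h (Nat.not_lt_zero _)
  | 0, _ + 1, _ => rfl
  | n + 1, k + 1, h => by
    rw [gaussBinom, gaussBinom_eq_zero_of_lt (by omega), gaussBinom_eq_zero_of_lt (by omega)]
    simp

theorem gaussBinom_self : ∀ n : ℕ, gaussBinom q n n = 1
  | 0 => rfl
  | n + 1 => by
    rw [gaussBinom, gaussBinom_self n, gaussBinom_eq_zero_of_lt q n.lt_succ_self]
    simp

theorem qPoch_succ (n : ℕ) : qPoch q (n + 1) = qPoch q n * (1 - q ^ (n + 1)) :=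
  Finset.prod_range_succ _ _

theorem gaussBinom_mul_qPoch_mul_qPoch :
    ∀ k l : ℕ, gaussBinom q (k + l) k * qPoch q k * qPoch q l = qPoch q (k + l)
  | 0, l => by simp [gaussBinom_zero_right, qPoch]
  | k + 1, 0 => by simp [gaussBinom_self, qPoch]
  | k + 1, l + 1 => by
    have h1 := gaussBinom_mul_qPoch_mul_qPoch k (l + 1)
    have h2 := gaussBinom_mul_qPoch_mul_qPoch (k + 1) l
    rw [show k + 1 + l = k + l + 1 by ring] at h2
    rw [← add_assoc] at h1
    rw [show k + 1 + (l + 1) = k + l + 1 + 1 by ring, gaussBinom, qPoch_succ q (k + l + 1)]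
    rw [qPoch_succ q l] at h1 ⊢
    rw [qPoch_succ q k] at h2 ⊢
    linear_combination (1 - q ^ (k + 1)) * h1 + q ^ (k + 1) * (1 - q ^ (l + 1)) * h2

/-- The homogeneous `q`-binomial theorem. -/
theorem prod_add_mul_pow_eq_sum (y : R) (N : ℕ) : ∀ x : R,
    ∏ i ∈ Finset.range N, (y + x * q ^ i) =
      ∑ k ∈ Finset.range (N + 1), gaussBinom q N k * q ^ k.choose 2 * x ^ k * y ^ (N - k) := by
  induction N with
  | zero => simp [gaussBinom_zero_right]
  | succ N ih =>
    intro x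
    have hshift : ∏ i ∈ Finset.range N, (y + x * q ^ (i + 1)) =
        ∏ i ∈ Finset.range N, (y + x * q * q ^ i) :=
      Finset.prod_congr rfl fun i _ => by ring
    rw [Finset.prod_range_succ', hshift, ih, Finset.sum_range_succ' _ (N + 1), pow_zero, mul_one,
      mul_add, Finset.sum_mul _ _ y]
    have hy : ∑ k ∈ Finset.range (N + 1),
          gaussBinom q N k * q ^ k.choose 2 * (x * q) ^ k * y ^ (N - k) * y =
        y ^ (N + 1) + ∑ k ∈ Finset.range (N + 1),
          q ^ (k + 1) * gaussBinom q N (k + 1) * q ^ (k + 1).choose 2 * x ^ (k + 1) *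
            y ^ (N - k) := by
      rw [Finset.sum_range_succ', Finset.sum_range_succ _ N,
        gaussBinom_eq_zero_of_lt q N.lt_succ_self]
      simp only [gaussBinom_zero_right, Nat.choose_zero_succ, pow_zero, mul_zero, zero_mul,
        add_zero, Nat.sub_zero, one_mul]
      rw [add_comm, ← pow_succ]
      congr 1
      refine Finset.sum_congr rfl fun k hk => ?_
      rw [show N - k = N - (k + 1) + 1 by have := Finset.mem_range.mp hk; omega]
      ring
    rw [hy, Finset.sum_mul _ _ x]
    simp only [gaussBinom, Nat.choose_zero_succ, pow_zero, Nat.sub_zero, one_mul,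
      Nat.add_sub_add_right]
    rw [add_assoc, ← Finset.sum_add_distrib, add_comm]
    congr 1
    refine Finset.sum_congr rfl fun k _ => ?_
    rw [Nat.choose_succ_succ' k 1, Nat.choose_one_right]
    ring

end GaussBinom

/-! ### The Jacobi triple product -/

/-- The triangular number `t (t + 1) / 2` of an integer `t`. -/
def tri (t : ℤ) : ℕ := (t * (t + 1) / 2).toNat

theorem two_mul_tri (t : ℤ) : 2 * (tri t : ℤ) = t * (t + 1) := by
  have h0 : 0 ≤ t * (t + 1) := by
    rcases le_or_gt 0 t with h | h <;> nlinarith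
  rw [tri, Int.toNat_of_nonneg (by positivity)]
  exact Int.mul_ediv_cancel' (Int.even_mul_succ_self t).two_dvd

theorem abs_le_tri_add_one (t : ℤ) : |t| ≤ tri t + 1 := by
  have := two_mul_tri t
  rw [abs_le]
  constructor <;> nlinarith [sq_nonneg (t + 1), sq_nonneg (t - 1), sq_nonneg t]

theorem finite_tri_le (N : ℕ) : {t : ℤ | tri t ≤ N}.Finite := by
  refine (Set.finite_Icc (-(N + 1 : ℤ)) (N + 1)).subset fun t ht => ?_
  have h1 := abs_le.mp (abs_le_tri_add_one t)
  have h2 : (tri t : ℤ) ≤ N := by exact_mod_cast ht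
  exact ⟨by linarith [h1.1], by linarith [h1.2]⟩

/-- The exponent of the `t`-th term of Ramanujan's theta series `f(q ^ a, q ^ b)`. -/
def thetaExp (a b : ℕ) (t : ℤ) : ℕ := a * tri t + b * tri (t - 1)

theorem two_mul_thetaExp (a b : ℕ) (t : ℤ) :
    2 * (thetaExp a b t : ℤ) = a * (t * (t + 1)) + b * ((t - 1) * t) := by
  have h1 := two_mul_tri t
  have h2 := two_mul_tri (t - 1)
  rw [sub_add_cancel] at h2
  push_cast [thetaExp]
  linear_combination a * h1 + b * h2

theorem finite_thetaExp_le {a b : ℕ} (hab : 0 < a + b) (N : ℕ) :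
    {t : ℤ | thetaExp a b t ≤ N}.Finite := by
  rcases Nat.eq_zero_or_pos a with ha | ha
  · refine ((finite_tri_le N).preimage (sub_left_injective (b := (1 : ℤ))).injOn).subset ?_
    intro t ht
    have hb : 0 < b := by omega
    have : b * tri (t - 1) ≤ N := le_trans (Nat.le_add_left _ _) ht
    exact le_trans (Nat.le_mul_of_pos_left _ hb) this
  · refine (finite_tri_le N).subset fun t ht => ?_
    have : a * tri t ≤ N := le_trans (Nat.le_add_right _ _) ht
    exact le_trans (Nat.le_mul_of_pos_left _ ha) this

theorem X_pow_dvd_monomial (n : ℕ) (r : ℚ) : (X : ℚ⟦X⟧) ^ n ∣ monomial n r := by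
  rw [monomial_eq_C_mul_X_pow]
  exact dvd_mul_left _ _

theorem multipliable_one_sub_X_pow_mul {c : ℕ} (hc : 0 < c) :
    Multipliable fun n : ℕ => 1 - (X : ℚ⟦X⟧) ^ (c * (n + 1)) := by
  refine multipliable_of_X_pow_dvd fun n => ?_
  rw [sub_sub_cancel_left, dvd_neg]
  exact pow_dvd_pow _ (by nlinarith)

theorem constantCoeff_phi {c : ℕ} (hc : 0 < c) : constantCoeff (phi c) = 1 := by
  refine constantCoeff_tprod (fun n => ?_) fun n => ?_
  · rw [sub_sub_cancel_left, dvd_neg]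
    exact pow_dvd_pow _ (by nlinarith)
  · have : c * (n + 1) ≠ 0 := by positivity
    simp [this]

theorem phi_ne_zero {c : ℕ} (hc : 0 < c) : phi c ≠ 0 := by
  intro h
  have := constantCoeff_phi hc
  simp [h] at this

theorem X_pow_dvd_qPoch_sub {c : ℕ} (hc : 0 < c) {m n : ℕ} (hmn : m ≤ n) :
    (X : ℚ⟦X⟧) ^ m ∣ qPoch (X ^ c) n - qPoch (X ^ c) m := by
  induction n, hmn using Nat.le_induction with
  | base => simp
  | succ n hmn ih =>
    rw [qPoch_succ, show qPoch ((X : ℚ⟦X⟧) ^ c) n * (1 - (X ^ c) ^ (n + 1)) - qPoch (X ^ c) m =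
      (qPoch (X ^ c) n - qPoch (X ^ c) m) - qPoch (X ^ c) n * (X ^ c) ^ (n + 1) by ring]
    refine dvd_sub ih (dvd_mul_of_dvd_right ?_ _)
    rw [← pow_mul]
    exact pow_dvd_pow _ (by nlinarith)

theorem X_pow_dvd_qPoch_sub_phi {c : ℕ} (hc : 0 < c) {m n : ℕ} (hmn : m ≤ n) :
    (X : ℚ⟦X⟧) ^ m ∣ qPoch (X ^ c) n - phi c := by
  have hlim : Tendsto (fun n => qPoch ((X : ℚ⟦X⟧) ^ c) n) atTop (𝓝 (phi c)) := by
    simpa only [qPoch, phi, pow_mul] using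
      (multipliable_one_sub_X_pow_mul hc).tendsto_prod_tprod_nat
  refine X_pow_dvd_iff.mpr fun d hd => ?_
  have h1 := (tendsto_iff_coeff_tendsto _ _ _).mp hlim d
  have h2 : Tendsto (fun k => coeff d (qPoch ((X : ℚ⟦X⟧) ^ c) k)) atTop
      (𝓝 (coeff d (qPoch ((X : ℚ⟦X⟧) ^ c) n))) := by
    refine tendsto_nhds_of_eventually_eq ?_
    filter_upwards [eventually_ge_atTop n] with k hk
    have := coeff_eq_zero_of_X_pow_dvd (X_pow_dvd_qPoch_sub hc hk) (hd.trans_le hmn)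
    rwa [map_sub, sub_eq_zero] at this
  rw [map_sub, sub_eq_zero]
  exact tendsto_nhds_unique h2 h1

/-- Central Gaussian binomial coefficients converge to the inverse of `phi`. -/
theorem X_pow_dvd_gaussBinom_mul_phi_sub_one {c : ℕ} (hc : 0 < c) {D k l : ℕ}
    (hk : D ≤ k) (hl : D ≤ l) :
    (X : ℚ⟦X⟧) ^ D ∣ gaussBinom (X ^ c) (k + l) k * phi c - 1 := by
  obtain ⟨u, hu⟩ := X_pow_dvd_qPoch_sub_phi hc hk
  obtain ⟨v, hv⟩ := X_pow_dvd_qPoch_sub_phi hc hl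
  obtain ⟨w, hw⟩ := X_pow_dvd_qPoch_sub_phi hc (le_add_right hk : D ≤ k + l)
  have h := gaussBinom_mul_qPoch_mul_qPoch ((X : ℚ⟦X⟧) ^ c) k l
  have hunit : IsUnit (phi c) := by
    rw [isUnit_iff_constantCoeff, constantCoeff_phi hc]
    exact isUnit_one
  refine (hunit.dvd_mul_left (a := X ^ D)).mp
    ⟨w - gaussBinom (X ^ c) (k + l) k * (u * qPoch (X ^ c) l + phi c * v), ?_⟩
  linear_combination h + hw - gaussBinom ((X : ℚ⟦X⟧) ^ c) (k + l) k * qPoch (X ^ c) l * hu -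
    gaussBinom ((X : ℚ⟦X⟧) ^ c) (k + l) k * phi c * hv

theorem prod_range_C_mul_X_pow (a c : ℕ) (ε : ℚ) (n : ℕ) :
    ∏ j ∈ Finset.range n, (C ε * (X : ℚ⟦X⟧) ^ (a + c * j)) =
      C ε ^ n * X ^ (a * n + c * n.choose 2) := by
  induction n with
  | zero => simp
  | succ n ih =>
    rw [Finset.prod_range_succ, ih, Nat.choose_succ_succ' n 1, Nat.choose_one_right]
    ring

/-- The finite form of the Jacobi triple product. -/
theorem prod_mul_prod_eq_sum_gaussBinom (a b : ℕ) {ε : ℚ} (hε : ε * ε = 1) (n : ℕ) :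
    (∏ i ∈ Finset.range n, (1 + C ε * (X : ℚ⟦X⟧) ^ ((a + b) * i + a))) *
      ∏ i ∈ Finset.range n, (1 + C ε * (X : ℚ⟦X⟧) ^ ((a + b) * i + b)) =
    ∑ k ∈ Finset.range (2 * n + 1), gaussBinom (X ^ (a + b)) (2 * n) k *
      monomial (thetaExp a b (k - n)) (ε ^ ((k : ℤ) - n)) := by
  have hε0 : ε ≠ 0 := by rintro rfl; simp at hε
  have hCε : C ε * C ε = (1 : ℚ⟦X⟧) := by rw [← map_mul, hε, map_one]
  have hC0 : (C ε : ℚ⟦X⟧) ≠ 0 := left_ne_zero_of_mul_eq_one hCε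
  set c := a + b with hc
  have hne : C ε ^ n * (X : ℚ⟦X⟧) ^ (a * n + c * n.choose 2) * X ^ (c * n * n) ≠ 0 :=
    mul_ne_zero (mul_ne_zero (pow_ne_zero _ hC0) (pow_ne_zero _ X_ne_zero))
      (pow_ne_zero _ X_ne_zero)
  refine mul_left_cancel₀ hne ?_
  have hbinom := prod_add_mul_pow_eq_sum ((X : ℚ⟦X⟧) ^ c) (X ^ (c * n)) (2 * n) (C ε * X ^ a)
  have hlow : ∏ i ∈ Finset.range n, ((X : ℚ⟦X⟧) ^ (c * n) + C ε * X ^ a * (X ^ c) ^ i) =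
      C ε ^ n * X ^ (a * n + c * n.choose 2) *
        ∏ i ∈ Finset.range n, (1 + C ε * (X : ℚ⟦X⟧) ^ (c * i + b)) := by
    rw [← prod_range_C_mul_X_pow, ← Finset.prod_range_reflect _ n,
      ← Finset.prod_range_reflect (fun j => C ε * (X : ℚ⟦X⟧) ^ (a + c * j)) n,
      ← Finset.prod_mul_distrib]
    refine Finset.prod_congr rfl fun j hj => ?_
    obtain ⟨i, hi⟩ : ∃ i, n = i + j + 1 :=
      ⟨n - 1 - j, by have := Finset.mem_range.mp hj; omega⟩
    have hij : n - 1 - j = i := by omega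
    rw [hij, mul_add, mul_one, mul_mul_mul_comm, hCε, one_mul, ← pow_add,
      show a + c * i + (c * j + b) = c * n by rw [hi, hc]; ring]
    ring
  have hhigh : ∏ i ∈ Finset.range n, ((X : ℚ⟦X⟧) ^ (c * n) + C ε * X ^ a * (X ^ c) ^ (n + i)) =
      X ^ (c * n * n) * ∏ i ∈ Finset.range n, (1 + C ε * (X : ℚ⟦X⟧) ^ (c * i + a)) := by
    have hconst : (X : ℚ⟦X⟧) ^ (c * n * n) = ∏ _i ∈ Finset.range n, X ^ (c * n) := by
      simp [pow_mul]
    rw [hconst, ← Finset.prod_mul_distrib]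
    exact Finset.prod_congr rfl fun j _ => by ring
  rw [two_mul, Finset.prod_range_add, hlow, hhigh, ← two_mul] at hbinom
  rw [Finset.mul_sum, mul_comm (∏ i ∈ _, _), ← mul_assoc, mul_right_comm _ (X ^ (c * n * n)),
    mul_assoc (_ * _), hbinom]
  refine Finset.sum_congr rfl fun k hk => ?_
  obtain ⟨l, hl⟩ : ∃ l, 2 * n = k + l :=
    ⟨2 * n - k, by have := Finset.mem_range.mp hk; omega⟩
  have hexp : c * k.choose 2 + a * k + c * n * l =
      a * n + c * n.choose 2 + c * n * n + thetaExp a b (k - n) := by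
    have h1 := two_mul_thetaExp a b (k - n)
    have hch (m : ℕ) : 2 * (m.choose 2 : ℤ) = m * (m - 1) := by
      cases m with
      | zero => simp
      | succ m =>
        have h := Nat.add_one_mul_choose_eq m 1
        rw [Nat.choose_one_right] at h
        have h' : ((m + 1 : ℕ) : ℤ) * m = (m + 1).choose 2 * 2 := by exact_mod_cast h
        push_cast at h' ⊢
        linarith
    have h2 := hch k
    have h3 := hch n
    have hl' : (2 * n : ℤ) = k + l := by exact_mod_cast hl
    have hc' : (c : ℤ) = a + b := by exact_mod_cast hc
    zify
    rw [show (l : ℤ) = 2 * n - k by linarith]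
    refine mul_left_cancel₀ (two_ne_zero (α := ℤ)) ?_
    rw [hc']
    linear_combination (a + b : ℤ) * h2 - (a + b : ℤ) * h3 - h1
  have hpow : ε ^ k = ε ^ n * ε ^ ((k : ℤ) - n) := by
    rw [← zpow_natCast, ← zpow_natCast, ← zpow_add₀ hε0]
    congr 1
    ring
  rw [hl, Nat.add_sub_cancel_left, monomial_eq_C_mul_X_pow, mul_pow, ← map_pow, hpow, map_mul,
    map_pow]
  simp only [← pow_mul]
  linear_combination gaussBinom ((X : ℚ⟦X⟧) ^ c) (k + l) k * C ε ^ n *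
    C (ε ^ ((k : ℤ) - n)) * congrArg (fun e => (X : ℚ⟦X⟧) ^ e) hexp

theorem multipliable_one_add_C_mul_X_pow {c : ℕ} (hc : 0 < c) (a : ℕ) (ε : ℚ) :
    Multipliable fun n : ℕ => 1 + C ε * (X : ℚ⟦X⟧) ^ (c * n + a) := by
  refine multipliable_of_X_pow_dvd fun n => ?_
  rw [add_sub_cancel_left]
  exact dvd_mul_of_dvd_right (pow_dvd_pow _ (by nlinarith)) _

/-- The Jacobi triple product identity for Ramanujan's theta series `f(ε q ^ a, ε q ^ b)`. -/
theorem jacobi_triple_product (a b : ℕ) (hab : 0 < a + b) {ε : ℚ} (hε : ε * ε = 1) :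
    phi (a + b) * ((∏' n : ℕ, (1 + C ε * (X : ℚ⟦X⟧) ^ ((a + b) * n + a))) *
      ∏' n : ℕ, (1 + C ε * (X : ℚ⟦X⟧) ^ ((a + b) * n + b))) =
    ∑' t : ℤ, monomial (thetaExp a b t) (ε ^ t) := by
  have hprod := (((multipliable_one_add_C_mul_X_pow hab a ε).tendsto_prod_tprod_nat).mul
    (multipliable_one_add_C_mul_X_pow hab b ε).tendsto_prod_tprod_nat).const_mul (phi (a + b))
  simp only [prod_mul_prod_eq_sum_gaussBinom a b hε] at hprod
  refine tendsto_nhds_unique hprod ?_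
  let f : ℕ → ℤ → ℚ⟦X⟧ := fun n t =>
    if -(n : ℤ) ≤ t then
      gaussBinom (X ^ (a + b)) (2 * n) (n + t).toNat * phi (a + b) *
        monomial (thetaExp a b t) (ε ^ t)
    else 0
  have hfsum (n : ℕ) : phi (a + b) * ∑ k ∈ Finset.range (2 * n + 1),
      gaussBinom (X ^ (a + b)) (2 * n) k *
        monomial (thetaExp a b (k - n)) (ε ^ ((k : ℤ) - n)) = ∑' t, f n t := by
    have hinj : Function.Injective fun k : ℕ => (k : ℤ) - n := fun k l h => by
      simpa using h
    rw [← hinj.tsum_eq, tsum_eq_sum (s := Finset.range (2 * n + 1)), Finset.mul_sum]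
    · refine Finset.sum_congr rfl fun k _ => ?_
      simp only [f]
      rw [if_pos (by omega), add_sub_cancel, Int.toNat_natCast]
      ring
    · intro k hk
      simp only [f]
      rw [if_pos (by omega), add_sub_cancel, Int.toNat_natCast, gaussBinom_eq_zero_of_lt]
      · simp
      · simpa [Nat.lt_succ_iff] using hk
    · intro t ht
      by_cases h : -(n : ℤ) ≤ t
      · exact ⟨(n + t).toNat, by simp only; omega⟩
      · simp [f, h] at ht
  simp only [hfsum]
  refine tendsto_tsum_of_X_pow_dvd (finite_thetaExp_le hab) (fun n t => ?_)
    (fun t => X_pow_dvd_monomial _ _) fun t => ?_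
  · by_cases h : -(n : ℤ) ≤ t
    · simp only [f, if_pos h]
      exact dvd_mul_of_dvd_right (X_pow_dvd_monomial _ _) _
    · simp [f, h]
  · refine tendsto_of_eventually_X_pow_dvd_sub fun D => ?_
    filter_upwards [eventually_ge_atTop (D + t.natAbs)] with n hn
    simp only [f]
    rw [if_pos (by omega), ← sub_one_mul]
    refine dvd_mul_of_dvd_left ?_ _
    have := X_pow_dvd_gaussBinom_mul_phi_sub_one hab (D := D) (k := (n + t).toNat)
      (l := (n - t).toNat) (by omega) (by omega)
    rwa [show (n + t).toNat + (n - t).toNat = 2 * n by omega] at this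

/-! ### Sums over pairs of triangular numbers -/

theorem two_ne_zero_powerSeries : (2 : ℚ⟦X⟧) ≠ 0 := fun h => by
  have h' := congrArg (constantCoeff (R := ℚ)) h
  rw [map_ofNat, map_zero] at h'
  norm_num at h'

theorem neg_one_zpow_congr {x y k : ℤ} (h : x = y + 2 * k) : (-1 : ℚ) ^ x = (-1) ^ y := by
  rw [h, zpow_add₀ (by norm_num), zpow_mul]
  norm_num

theorem finite_tri_add_tri_le (N : ℕ) : {p : ℤ × ℤ | tri p.1 + tri p.2 ≤ N}.Finite :=
  ((finite_tri_le N).prod (finite_tri_le N)).subset fun _ hp =>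
    ⟨le_trans (Nat.le_add_right _ _) hp, le_trans (Nat.le_add_left _ _) hp⟩

theorem summable_monomial_tri (g : ℤ × ℤ → ℚ) :
    Summable fun p : ℤ × ℤ => (monomial (tri p.1 + tri p.2) (g p) : ℚ⟦X⟧) :=
  summable_of_X_pow_dvd finite_tri_add_tri_le fun _ => X_pow_dvd_monomial _ _

/-- The series `∑ g(r, s) q ^ (r (r + 1) / 2 + s (s + 1) / 2)` over all integers `r` and `s`. -/
noncomputable def triSum : (ℤ × ℤ → ℚ) →ₗ[ℚ] ℚ⟦X⟧ where
  toFun g := ∑' p : ℤ × ℤ, monomial (tri p.1 + tri p.2) (g p)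
  map_add' g h := by
    simp only [Pi.add_apply, map_add]
    exact (summable_monomial_tri g).tsum_add (summable_monomial_tri h)
  map_smul' c g := by
    simp only [Pi.smul_apply, RingHom.id_apply, map_smul, smul_eq_C_mul]
    exact (summable_monomial_tri g).tsum_mul_left _

theorem triSum_apply (g : ℤ × ℤ → ℚ) :
    triSum g = ∑' p : ℤ × ℤ, monomial (tri p.1 + tri p.2) (g p) := rfl

theorem triSum_eq_tsum_comp {g : ℤ × ℤ → ℚ} {j : ℤ × ℤ → ℤ × ℤ} (hj : Function.Injective j)
    (hg : ∀ p, g p ≠ 0 → p ∈ Set.range j) :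
    triSum g = ∑' p : ℤ × ℤ, monomial (tri (j p).1 + tri (j p).2) (g (j p)) := by
  refine (hj.tsum_eq (f := fun p => (monomial (tri p.1 + tri p.2) (g p) : ℚ⟦X⟧)) ?_).symm
  intro p hp
  refine hg p fun h => hp ?_
  simp [h]

theorem tri_neg_one_sub (r : ℤ) : tri (-1 - r) = tri r := by
  have h1 := two_mul_tri r
  have h2 := two_mul_tri (-1 - r)
  zify
  linarith

theorem triSum_swap (g : ℤ × ℤ → ℚ) : triSum (fun p => g (p.2, p.1)) = triSum g := by
  rw [triSum_eq_tsum_comp (g := g) (Equiv.prodComm ℤ ℤ).injective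
    fun p _ => (Equiv.prodComm ℤ ℤ).surjective p, triSum_apply]
  simp [add_comm, Prod.swap]

theorem triSum_reflect_fst (g : ℤ × ℤ → ℚ) : triSum (fun p => g (-1 - p.1, p.2)) = triSum g := by
  have hinv : Function.Involutive fun p : ℤ × ℤ => (-1 - p.1, p.2) := fun p => by simp
  rw [triSum_eq_tsum_comp (g := g) hinv.injective fun p _ => hinv.surjective p, triSum_apply]
  simp only [tri_neg_one_sub]

theorem triSum_reflect_snd (g : ℤ × ℤ → ℚ) : triSum (fun p => g (p.1, -1 - p.2)) = triSum g := by
  have hinv : Function.Involutive fun p : ℤ × ℤ => (p.1, -1 - p.2) := fun p => by simp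
  rw [triSum_eq_tsum_comp (g := g) hinv.injective fun p _ => hinv.surjective p, triSum_apply]
  simp only [tri_neg_one_sub]

/-- The sign `(-1) ^ (r (r + 1) / 2)`. -/
def triSign (r : ℤ) : ℚ := (-1) ^ (tri r : ℤ)

theorem triSign_neg_one_sub (r : ℤ) : triSign (-1 - r) = triSign r := by
  rw [triSign, tri_neg_one_sub, triSign]

theorem triSign_eq_neg {r s k : ℤ} (h : r * (r + 1) = s * (s + 1) + 4 * k + 2) :
    triSign r = -triSign s := by
  have h1 := two_mul_tri r
  have h2 := two_mul_tri s
  rw [triSign, triSign,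
    neg_one_zpow_congr (x := (tri r : ℤ)) (y := tri s + 1) (k := k) (by linarith),
    zpow_add₀ (by norm_num)]
  simp

/-- The weight of the pair `(r, s)`. -/
def triWeight (p : ℤ × ℤ) : ℚ := triSign p.1 + triSign p.2

/-- The weight of `p` if `5` divides `u`, and `0` otherwise. -/
def weightIf (u : ℤ) (p : ℤ × ℤ) : ℚ := if 5 ∣ u then triWeight p else 0

/-- Multiplication by the unimodular number `(2 + i) / (2 - i)` shows that the points of the
lattice divisible by `2 + i` do not contribute. -/
theorem triSum_weightIf_ideal :
    triSum (fun p => weightIf (p.1 - 2 * p.2 + 2) p) = 0 ∧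
      triSum (fun p => weightIf (p.1 + 2 * p.2 - 1) p) = 0 := by
  have hreflect : triSum (fun p => weightIf (p.1 - 2 * p.2 + 2) p) =
      triSum (fun p => weightIf (p.1 + 2 * p.2 - 1) p) := by
    rw [← triSum_reflect_fst]
    congr 1
    funext p
    simp only [weightIf, triWeight, triSign_neg_one_sub]
    congr 1
    rw [← dvd_neg]
    ring_nf
  have hrotate : triSum (fun p => weightIf (p.1 - 2 * p.2 + 2) p) =
      -triSum (fun p => weightIf (p.1 + 2 * p.2 - 1) p) := by
    rw [← map_neg,
      triSum_eq_tsum_comp (j := fun p => (2 * p.1 - p.2, p.1 + 2 * p.2 + 1)),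
      triSum_eq_tsum_comp (j := fun p => (2 * p.1 + p.2 + 1, 2 * p.2 - p.1))]
    · refine tsum_congr fun p => ?_
      have hexp : tri (2 * p.1 - p.2) + tri (p.1 + 2 * p.2 + 1) =
          tri (2 * p.1 + p.2 + 1) + tri (2 * p.2 - p.1) := by
        have h1 := two_mul_tri (2 * p.1 - p.2)
        have h2 := two_mul_tri (p.1 + 2 * p.2 + 1)
        have h3 := two_mul_tri (2 * p.1 + p.2 + 1)
        have h4 := two_mul_tri (2 * p.2 - p.1)
        zify
        linarith
      have hs1 : triSign (2 * p.1 - p.2) = -triSign (2 * p.1 + p.2 + 1) :=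
        triSign_eq_neg (k := -2 * p.1 * p.2 - p.1 - p.2 - 1) (by ring)
      have hs2 : triSign (p.1 + 2 * p.2 + 1) = -triSign (2 * p.2 - p.1) :=
        triSign_eq_neg (k := 2 * p.1 * p.2 + p.1 + p.2) (by ring)
      simp only [hexp, Pi.neg_apply, weightIf, triWeight, hs1, hs2]
      rw [if_pos (by omega), if_pos (by omega)]
      congr 1
      ring
    · intro p q h
      simp only [Prod.mk.injEq] at h
      ext <;> omega
    · intro p hp
      have h5 : 5 ∣ p.1 + 2 * p.2 - 1 := by
        by_contra h
        simp [weightIf, h] at hp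
      obtain ⟨n, hn⟩ := h5
      exact ⟨(2 * n - p.2, n), by ext <;> simp only <;> omega⟩
    · intro p q h
      simp only [Prod.mk.injEq] at h
      ext <;> omega
    · intro p hp
      have h5 : 5 ∣ p.1 - 2 * p.2 + 2 := by
        by_contra h
        simp [weightIf, h] at hp
      obtain ⟨n, hn⟩ := h5
      exact ⟨(p.2 - 1 + 2 * n, -n), by ext <;> simp only <;> omega⟩
  have hzero : triSum (fun p => weightIf (p.1 + 2 * p.2 - 1) p) = 0 :=
    mul_left_cancel₀ two_ne_zero_powerSeries (by linear_combination hrotate - hreflect)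
  exact ⟨hreflect.trans hzero, hzero⟩

/-- The eight images of the line `s = 2 r` modulo `5` under the symmetries of the square cover
every residue class twice, up to the two ideals of norm `5`. -/
theorem sum_weightIf_symmetries (p : ℤ × ℤ) :
    weightIf (p.2 - 2 * p.1) p + weightIf (p.2 - 2 * (-1 - p.1)) p +
      weightIf (-1 - p.2 - 2 * p.1) p + weightIf (-1 - p.2 - 2 * (-1 - p.1)) p +
      weightIf (p.1 - 2 * p.2) p + weightIf (p.1 - 2 * (-1 - p.2)) p +
      weightIf (-1 - p.1 - 2 * p.2) p + weightIf (-1 - p.1 - 2 * (-1 - p.2)) p +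
      weightIf (p.1 - 2 * p.2 + 2) p + weightIf (p.1 + 2 * p.2 - 1) p = 2 * triWeight p := by
  have hcount : ∀ r s : ZMod 5,
      (if s - 2 * r = 0 then 1 else 0) + (if s - 2 * (-1 - r) = 0 then 1 else 0) +
      (if -1 - s - 2 * r = 0 then 1 else 0) + (if -1 - s - 2 * (-1 - r) = 0 then 1 else 0) +
      (if r - 2 * s = 0 then 1 else 0) + (if r - 2 * (-1 - s) = 0 then 1 else 0) +
      (if -1 - r - 2 * s = 0 then 1 else 0) + (if -1 - r - 2 * (-1 - s) = 0 then 1 else 0) +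
      (if r - 2 * s + 2 = 0 then 1 else 0) + (if r + 2 * s - 1 = 0 then 1 else 0) = 2 := by
    decide
  have h (u : ℤ) :
      weightIf u p = ((if (u : ZMod 5) = 0 then 1 else 0 : ℕ) : ℚ) * triWeight p := by
    have hu : (u : ZMod 5) = 0 ↔ 5 ∣ u := by
      simpa using ZMod.intCast_zmod_eq_zero_iff_dvd u 5
    by_cases h5 : 5 ∣ u <;> simp [weightIf, hu, h5]
  have hcast := congrArg (fun n : ℕ => (n : ℚ) * triWeight p) (hcount p.1 p.2)
  simp only [h]
  push_cast at hcast ⊢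
  linear_combination hcast

theorem four_mul_triSum_weightIf :
    4 * triSum (fun p => weightIf (p.2 - 2 * p.1) p) = triSum triWeight := by
  obtain ⟨hplus, hminus⟩ := triSum_weightIf_ideal
  have hw1 (u : ℤ) (p : ℤ × ℤ) : weightIf u (-1 - p.1, p.2) = weightIf u p := by
    simp [weightIf, triWeight, triSign_neg_one_sub]
  have hw2 (u : ℤ) (p : ℤ × ℤ) : weightIf u (p.1, -1 - p.2) = weightIf u p := by
    simp [weightIf, triWeight, triSign_neg_one_sub]
  have hw3 (u : ℤ) (p : ℤ × ℤ) : weightIf u (p.2, p.1) = weightIf u p := by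
    simp [weightIf, triWeight, add_comm]
  have h1 (v : ℤ → ℤ → ℤ) : triSum (fun p => weightIf (v (-1 - p.1) p.2) p) =
      triSum (fun p => weightIf (v p.1 p.2) p) := by
    simpa only [hw1] using triSum_reflect_fst fun p => weightIf (v p.1 p.2) p
  have h2 (v : ℤ → ℤ → ℤ) : triSum (fun p => weightIf (v p.1 (-1 - p.2)) p) =
      triSum (fun p => weightIf (v p.1 p.2) p) := by
    simpa only [hw2] using triSum_reflect_snd fun p => weightIf (v p.1 p.2) p
  have h3 (v : ℤ → ℤ → ℤ) : triSum (fun p => weightIf (v p.2 p.1) p) =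
      triSum (fun p => weightIf (v p.1 p.2) p) := by
    simpa only [hw3] using triSum_swap fun p => weightIf (v p.1 p.2) p
  have hsum := congrArg triSum (funext sum_weightIf_symmetries)
  have hadd (g h : ℤ × ℤ → ℚ) : triSum (fun p => g p + h p) = triSum g + triSum h :=
    map_add triSum g h
  have hdouble : triSum (fun p => 2 * triWeight p) = 2 * triSum triWeight := by
    simp only [two_mul, hadd]
  simp only [hadd, hdouble, hplus, hminus] at hsum
  have e1 := h1 fun r s => s - 2 * r
  have e2 := h2 fun r s => s - 2 * r
  have e3 := h2 fun r s => s - 2 * (-1 - r)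
  have e4 := h3 fun r s => s - 2 * r
  have e5 := h3 fun r s => s - 2 * (-1 - r)
  have e6 := h3 fun r s => -1 - s - 2 * r
  have e7 := h3 fun r s => -1 - s - 2 * (-1 - r)
  rw [e7, e6, e5, e4, e3, e2, e1] at hsum
  refine mul_left_cancel₀ two_ne_zero_powerSeries ?_
  linear_combination hsum

/-! ### Products -/

theorem neg_X : neg X = -X := by
  ext n
  by_cases h : n = 1 <;> simp [neg, coeff_X, h]

theorem neg_one_sub_X_pow (n : ℕ) : neg (1 - X ^ n) = 1 - (-1) ^ n * X ^ n := by
  rw [map_sub, map_one, map_pow, neg_X, neg_pow]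

theorem neg_monomial (n : ℕ) (r : ℚ) : neg (monomial n r) = monomial n ((-1) ^ n * r) := by
  ext d
  rw [neg, coeff_rescale, coeff_monomial, coeff_monomial]
  split_ifs with h
  · rw [h]
  · simp

theorem phi_eq_tprod_odd_mul_phi {j : ℕ} (hj : 0 < j) :
    phi j = (∏' n : ℕ, (1 - (X : ℚ⟦X⟧) ^ (j * (2 * n + 1)))) * phi (2 * j) := by
  have hodd : Multipliable fun n : ℕ => 1 - (X : ℚ⟦X⟧) ^ (j * (2 * n + 1)) := by
    refine multipliable_of_X_pow_dvd fun n => ?_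
    rw [sub_sub_cancel_left, dvd_neg]
    exact pow_dvd_pow _ (by nlinarith)
  have heven := multipliable_one_sub_X_pow_mul (c := 2 * j) (by omega)
  have heven' : (fun n : ℕ => 1 - (X : ℚ⟦X⟧) ^ (2 * j * (n + 1))) =
      fun n => 1 - X ^ (j * (2 * n + 1 + 1)) := by
    funext n
    ring_nf
  rw [phi, phi, heven', ← tprod_even_mul_odd
    (f := fun n => 1 - (X : ℚ⟦X⟧) ^ (j * (n + 1))) hodd (heven' ▸ heven)]

theorem neg_phi_two : neg (phi 2) = phi 2 := by
  rw [phi, (multipliable_one_sub_X_pow_mul two_pos).map_tprod neg continuous_neg_hom]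
  refine tprod_congr fun n => ?_
  rw [neg_one_sub_X_pow, pow_mul (-1), neg_one_sq, one_pow, one_mul]

theorem phi_one_mul_neg_phi_one : phi 1 * neg (phi 1) * phi 4 = phi 2 ^ 3 := by
  have hdvd (e : ℕ → ℕ) (he : ∀ n, n ≤ e n) (r : ℚ⟦X⟧) (n : ℕ) :
      (X : ℚ⟦X⟧) ^ n ∣ (1 + r * X ^ e n) - 1 := by
    rw [add_sub_cancel_left]
    exact dvd_mul_of_dvd_right (pow_dvd_pow _ (he n)) _
  have hm1 : Multipliable fun n : ℕ => 1 - (X : ℚ⟦X⟧) ^ (1 * (2 * n + 1)) := by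
    refine multipliable_of_X_pow_dvd fun n => ?_
    simpa [sub_eq_add_neg] using hdvd (fun n => 2 * n + 1) (fun n => by omega) (-1) n
  have hm2 : Multipliable fun n : ℕ => 1 + (X : ℚ⟦X⟧) ^ (2 * n + 1) := by
    refine multipliable_of_X_pow_dvd fun n => ?_
    simpa using hdvd (fun n => 2 * n + 1) (fun n => by omega) 1 n
  have h1 := phi_eq_tprod_odd_mul_phi one_pos
  have h2 := phi_eq_tprod_odd_mul_phi two_pos
  have hneg : neg (phi 1) = (∏' n : ℕ, (1 + (X : ℚ⟦X⟧) ^ (2 * n + 1))) * phi 2 := by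
    rw [h1, map_mul, hm1.map_tprod neg continuous_neg_hom, mul_one, neg_phi_two]
    congr 2
    funext n
    rw [neg_one_sub_X_pow, one_mul, pow_succ (-1 : ℚ⟦X⟧), pow_mul]
    simp
  have hcombine : (∏' n : ℕ, (1 - (X : ℚ⟦X⟧) ^ (1 * (2 * n + 1)))) *
      ∏' n : ℕ, (1 + (X : ℚ⟦X⟧) ^ (2 * n + 1)) =
      ∏' n : ℕ, (1 - (X : ℚ⟦X⟧) ^ (2 * (2 * n + 1))) := by
    rw [← hm1.tprod_mul hm2]
    congr 1
    funext n
    ring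
  rw [← hcombine] at h2
  rw [hneg]
  nth_rewrite 1 [h1]
  norm_num at h2 ⊢
  linear_combination -phi 2 ^ 2 * h2

/-- Gauss's evaluation of the generating function of triangular numbers. -/
theorem tsum_monomial_tri_mul_phi_one :
    (∑' t : ℤ, (monomial (tri t) 1 : ℚ⟦X⟧)) * phi 1 = 2 * phi 2 ^ 2 := by
  have hjacobi := jacobi_triple_product 0 1 one_pos (ε := 1) (by norm_num)
  have hshift : ∑' t : ℤ, (monomial (thetaExp 0 1 t) (1 ^ t) : ℚ⟦X⟧) =
      ∑' t : ℤ, monomial (tri t) 1 := by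
    rw [← (Equiv.subRight (1 : ℤ)).tsum_eq fun t => (monomial (tri t) 1 : ℚ⟦X⟧)]
    simp [thetaExp]
  have hmult : Multipliable fun n : ℕ => 1 + (X : ℚ⟦X⟧) ^ (n + 1) := by
    simpa using multipliable_one_add_C_mul_X_pow one_pos 1 1
  have hpeel : ∏' n : ℕ, (1 + (X : ℚ⟦X⟧) ^ n) = 2 * ∏' n : ℕ, (1 + (X : ℚ⟦X⟧) ^ (n + 1)) := by
    rw [tprod_eq_zero_mul' (f := fun n => 1 + (X : ℚ⟦X⟧) ^ n) hmult]
    norm_num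
  have hphi : phi 1 * ∏' n : ℕ, (1 + (X : ℚ⟦X⟧) ^ (n + 1)) = phi 2 := by
    rw [phi, phi, ← (multipliable_one_sub_X_pow_mul one_pos).tprod_mul hmult]
    congr 1
    funext n
    ring
  rw [hshift] at hjacobi
  simp only [zero_add, one_mul, map_one, add_zero] at hjacobi
  rw [hpeel] at hjacobi
  rw [← hjacobi, ← hphi]
  ring

theorem triSum_triWeight_mul :
    triSum triWeight * (phi 1 * neg (phi 1)) = 8 * phi 2 ^ 4 := by
  set ψ : ℚ⟦X⟧ := ∑' t : ℤ, monomial (tri t) 1 with hψ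
  have hsum (g : ℤ → ℚ) : Summable fun t : ℤ => (monomial (tri t) (g t) : ℚ⟦X⟧) :=
    summable_of_X_pow_dvd finite_tri_le fun _ => X_pow_dvd_monomial _ _
  have hneg : neg ψ = ∑' t : ℤ, monomial (tri t) (triSign t) := by
    rw [hψ, (hsum fun _ => 1).map_tsum neg continuous_neg_hom]
    simp [neg_monomial, triSign]
  have hmul (g h : ℤ → ℚ) : (∑' t : ℤ, (monomial (tri t) (g t) : ℚ⟦X⟧)) *
      ∑' t : ℤ, monomial (tri t) (h t) = triSum fun p => g p.1 * h p.2 := by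
    rw [(hsum g).tsum_mul_tsum (hsum h), triSum_apply]
    · simp [monomial_mul_monomial]
    · simpa [monomial_mul_monomial] using summable_monomial_tri fun p => g p.1 * h p.2
  have hw : triSum triWeight = 2 * (ψ * neg ψ) := by
    have h1 : ψ * neg ψ = triSum fun p => triSign p.2 := by
      rw [hneg, hψ, hmul]
      simp
    have h2 : neg ψ * ψ = triSum fun p => triSign p.1 := by
      rw [hneg, hψ, hmul]
      simp
    have h3 : triSum triWeight = (triSum fun p => triSign p.1) + triSum fun p => triSign p.2 :=
      map_add triSum (fun p : ℤ × ℤ => triSign p.1) fun p => triSign p.2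
    rw [h3, ← h1, ← h2]
    ring
  have hgauss : ψ * phi 1 = 2 * phi 2 ^ 2 := tsum_monomial_tri_mul_phi_one
  have hgauss' := congrArg neg hgauss
  rw [map_mul, map_mul, map_pow, neg_phi_two, map_ofNat] at hgauss'
  rw [hw]
  linear_combination 2 * (neg ψ * neg (phi 1)) * hgauss + 4 * phi 2 ^ 2 * hgauss'

/-! ### The Rogers–Ramanujan products as theta quotients -/

theorem tprod_inv_mul_tprod {f : ℕ → ℚ⟦X⟧} (h : ∀ n, X ^ n ∣ f n - 1)
    (h1 : ∀ n, constantCoeff (f n) = 1) : (∏' n, (f n)⁻¹) * ∏' n, f n = 1 := by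
  have hinv (n : ℕ) : (f n)⁻¹ * f n = 1 := PowerSeries.inv_mul_cancel _ (by simp [h1])
  have hm : Multipliable fun n => (f n)⁻¹ := by
    refine multipliable_of_X_pow_dvd fun n => ?_
    rw [show (f n)⁻¹ - 1 = -(f n)⁻¹ * (f n - 1) by linear_combination hinv n]
    exact dvd_mul_of_dvd_right (h n) _
  rw [← hm.tprod_mul (multipliable_of_X_pow_dvd h)]
  simp [hinv]

/-- A product over two residue classes modulo `5`, in the shape of the denominators of the
Rogers–Ramanujan products. -/
noncomputable def residuePair (a b : ℕ) : ℚ⟦X⟧ :=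
  ∏' n : ℕ, ((1 - X ^ (1 * (5 * n + a))) * (1 - X ^ (1 * (5 * n + b))))

theorem multipliable_one_sub_residue (a : ℕ) :
    Multipliable fun n : ℕ => 1 - (X : ℚ⟦X⟧) ^ (5 * n + a) := by
  simpa [sub_eq_add_neg] using multipliable_one_add_C_mul_X_pow (c := 5) (by norm_num) a (-1)

theorem residuePair_eq (a b : ℕ) : residuePair a b =
    (∏' n : ℕ, (1 - (X : ℚ⟦X⟧) ^ (5 * n + a))) * ∏' n : ℕ, (1 - (X : ℚ⟦X⟧) ^ (5 * n + b)) := by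
  rw [← (multipliable_one_sub_residue a).tprod_mul (multipliable_one_sub_residue b)]
  simp [residuePair]

theorem tprod_inv_mul_residuePair {a b : ℕ} (ha : 0 < a) (hb : 0 < b) :
    (∏' n : ℕ, ((1 - (X : ℚ⟦X⟧) ^ (1 * (5 * n + a))) * (1 - X ^ (1 * (5 * n + b))))⁻¹) *
      residuePair a b = 1 := by
  refine tprod_inv_mul_tprod (fun n => ?_) fun n => ?_
  · rw [show (1 - (X : ℚ⟦X⟧) ^ (1 * (5 * n + a))) * (1 - X ^ (1 * (5 * n + b))) - 1 =
      X ^ n * (-X ^ (4 * n + a) - X ^ (4 * n + b) + X ^ (9 * n + a + b)) by ring]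
    exact dvd_mul_right _ _
  · have ha' : 5 * n + a ≠ 0 := by omega
    have hb' : 5 * n + b ≠ 0 := by omega
    simp [zero_pow ha', zero_pow hb']

theorem phi_one_eq_residuePair : phi 1 = phi 5 * (residuePair 4 1 * residuePair 3 2) := by
  have h5 := multipliable_one_sub_X_pow_mul (c := 5) (by norm_num)
  have hr := multipliable_one_sub_residue
  have hblock : (fun n : ℕ => ∏ i ∈ Finset.range 5, (1 - (X : ℚ⟦X⟧) ^ (1 * (5 * n + i + 1)))) =
      fun n : ℕ => (1 - X ^ (5 * (n + 1))) * (((1 - X ^ (5 * n + 4)) * (1 - X ^ (5 * n + 1))) *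
        ((1 - X ^ (5 * n + 3)) * (1 - X ^ (5 * n + 2)))) := by
    funext n
    simp only [Finset.prod_range_succ, Finset.prod_range_zero]
    ring
  have h41 := (hr 4).mul (hr 1)
  have h32 := (hr 3).mul (hr 2)
  rw [residuePair_eq, residuePair_eq, ← (hr 4).tprod_mul (hr 1), ← (hr 3).tprod_mul (hr 2),
    ← h41.tprod_mul h32, phi, phi, ← h5.tprod_mul (h41.mul h32), ← hblock]
  refine tprod_eq_tprod_prod_range (by norm_num) (multipliable_one_sub_X_pow_mul one_pos) ?_
  rw [hblock]
  exact h5.mul (h41.mul h32)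

theorem phi_five_mul_residuePair (a b : ℕ) (hab : a + b = 5) :
    phi 5 * residuePair a b = ∑' t : ℤ, monomial (thetaExp a b t) ((-1) ^ t) := by
  have h := jacobi_triple_product a b (by omega) (ε := -1) (by norm_num)
  rw [← h, residuePair_eq, hab]
  simp [sub_eq_add_neg]

theorem H_mul_phi_one :
    H 1 * phi 1 = ∑' t : ℤ, monomial (thetaExp 4 1 t) ((-1) ^ t) := by
  have h : H 1 * residuePair 3 2 = 1 := tprod_inv_mul_residuePair (by norm_num) (by norm_num)
  rw [← phi_five_mul_residuePair 4 1 rfl, phi_one_eq_residuePair]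
  linear_combination phi 5 * residuePair 4 1 * h

theorem G_mul_phi_one :
    G 1 * phi 1 = ∑' t : ℤ, monomial (thetaExp 3 2 t) ((-1) ^ t) := by
  have h : G 1 * residuePair 4 1 = 1 := tprod_inv_mul_residuePair (by norm_num) (by norm_num)
  rw [← phi_five_mul_residuePair 3 2 rfl, phi_one_eq_residuePair]
  linear_combination phi 5 * residuePair 3 2 * h

/-- The change of variables `r = m + 2 n`, `s = 2 m - n` in the product of the theta series. -/
theorem watson_sum_eq_triSum :
    H 1 * phi 1 * neg (G 1 * phi 1) + neg (H 1 * phi 1) * (G 1 * phi 1) =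
      triSum fun p => weightIf (p.2 - 2 * p.1) p := by
  have hdvd (a b : ℕ) (g : ℤ → ℚ) (t : ℤ) :
      (X : ℚ⟦X⟧) ^ thetaExp a b t ∣ monomial (thetaExp a b t) (g t) := X_pow_dvd_monomial _ _
  have hsumH (g : ℤ → ℚ) := summable_of_X_pow_dvd (finite_thetaExp_le (by norm_num)) (hdvd 4 1 g)
  have hsumG (g : ℤ → ℚ) := summable_of_X_pow_dvd (finite_thetaExp_le (by norm_num)) (hdvd 3 2 g)
  have hexp (p : ℤ × ℤ) : thetaExp 4 1 p.1 + thetaExp 3 2 p.2 =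
      tri (p.1 + 2 * p.2) + tri (2 * p.1 - p.2) := by
    have h1 := two_mul_thetaExp 4 1 p.1
    have h2 := two_mul_thetaExp 3 2 p.2
    have h3 := two_mul_tri (p.1 + 2 * p.2)
    have h4 := two_mul_tri (2 * p.1 - p.2)
    push_cast at h1 h2
    zify
    linarith
  have hinj : Function.Injective fun p : ℤ × ℤ => (p.1 + 2 * p.2, 2 * p.1 - p.2) := by
    intro p q h
    simp only [Prod.mk.injEq] at h
    ext <;> omega
  have hsumHG (g : ℤ × ℤ → ℚ) : Summable fun p : ℤ × ℤ =>
      (monomial (thetaExp 4 1 p.1 + thetaExp 3 2 p.2) (g p) : ℚ⟦X⟧) := by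
    refine summable_of_X_pow_dvd (fun N => ?_) fun p => X_pow_dvd_monomial _ _
    simp only [hexp]
    exact (finite_tri_add_tri_le N).preimage hinj.injOn
  have hmul (g h : ℤ → ℚ) : (∑' t : ℤ, (monomial (thetaExp 4 1 t) (g t) : ℚ⟦X⟧)) *
      ∑' t : ℤ, monomial (thetaExp 3 2 t) (h t) =
      ∑' p : ℤ × ℤ, monomial (thetaExp 4 1 p.1 + thetaExp 3 2 p.2) (g p.1 * h p.2) := by
    rw [(hsumH g).tsum_mul_tsum (hsumG h)]
    · simp [monomial_mul_monomial]
    · simpa [monomial_mul_monomial] using hsumHG fun p => g p.1 * h p.2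
  rw [H_mul_phi_one, G_mul_phi_one, (hsumH _).map_tsum neg continuous_neg_hom,
    (hsumG _).map_tsum neg continuous_neg_hom]
  simp only [neg_monomial]
  rw [hmul, hmul, ← (hsumHG _).tsum_add (hsumHG _), triSum_eq_tsum_comp hinj]
  · refine tsum_congr fun p => ?_
    rw [← map_add, ← hexp]
    congr 1
    simp only [weightIf, triWeight, triSign]
    rw [if_pos ⟨-p.2, by ring⟩, add_comm]
    have h1 := two_mul_thetaExp 4 1 p.1
    have h2 := two_mul_thetaExp 3 2 p.2
    have h3 := two_mul_tri (p.1 + 2 * p.2)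
    have h4 := two_mul_tri (2 * p.1 - p.2)
    push_cast at h1 h2
    simp only [← zpow_natCast, ← zpow_add₀ (show (-1 : ℚ) ≠ 0 by norm_num)]
    congr 1
    · refine neg_one_zpow_congr (k := p.1 ^ 2 + p.1 - p.1 * p.2 - p.2 ^ 2) ?_
      linarith
    · refine neg_one_zpow_congr (k := p.2 ^ 2 + p.2 - p.1 ^ 2 + p.1 * p.2) ?_
      linarith
  · intro p hp
    have h5 : 5 ∣ p.2 - 2 * p.1 := by
      by_contra h
      simp [weightIf, h] at hp
    obtain ⟨n, hn⟩ := h5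
    exact ⟨(p.1 + 2 * n, -n), by ext <;> simp only <;> omega⟩

/-- One of Ramanujan's forty identities (Watson, 1933):
`H(q)G(−q) + H(−q)G(q) = 2 φ(q⁴)²/φ(q²)²`. -/
theorem ramanujan_watson_determinant :
    H 1 * neg (G 1) + neg (H 1) * G 1 = 2 * phi 4 ^ 2 * (phi 2 ^ 2)⁻¹ := by
  have hsum : (H 1 * neg (G 1) + neg (H 1) * G 1) * (phi 1 * neg (phi 1)) =
      triSum fun p => weightIf (p.2 - 2 * p.1) p := by
    rw [← watson_sum_eq_triSum, map_mul, map_mul]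
    ring
  have hfour := four_mul_triSum_weightIf
  have hweight := triSum_triWeight_mul
  have hphi := phi_one_mul_neg_phi_one
  rw [PowerSeries.eq_mul_inv_iff_mul_eq (by simp [constantCoeff_phi two_pos])]
  refine mul_left_cancel₀ (mul_ne_zero (mul_ne_zero two_ne_zero_powerSeries
    two_ne_zero_powerSeries) (pow_ne_zero 4 (phi_ne_zero two_pos))) ?_
  linear_combination
    -4 * (H 1 * neg (G 1) + neg (H 1) * G 1) *
      (phi 1 * neg (phi 1) * phi 4 + phi 2 ^ 3) * hphi +
    4 * (phi 1 * neg (phi 1)) * phi 4 ^ 2 * hsum + phi 1 * neg (phi 1) * phi 4 ^ 2 * hfour +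
    phi 4 ^ 2 * hweight
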